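/- arXiv:1609.09686 — 2 statements merged into one kernel-verified Lean document; each statement's English description precedes it below -/
import Mathlib

section
/- Let u be a family assigning to each subset I of a finite set S an element u_I of a commutative ring K. Then for every nonempty subset H ⊆ S, one has u_H = Σ_{π ∈ P(H)} ∏_{B∈π} κ_B(u), where the sum runs over all set partitions π of H into nonempty blocks. -/
/-- The set of all set partitions of a finite set `s` into nonempty blocks, encoded as
finsets of pairwise disjoint nonempty finsets whose union is `s`. -/
def partitionsOf {α : Type*} [DecidableEq α] (s : Finset α) : Finset (Finset (Finset α)) :=
  s.powerset.powerset.filter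
    (fun π => (∀ B ∈ π, B ≠ ∅) ∧ (∀ B ∈ π, ∀ B' ∈ π, B ≠ B' → B ∩ B' = ∅) ∧
      π.sup id = s)

/-- The partial cumulant `κ_H(u) = Σ_{π ∈ P(H)} (−1)^{#π−1}(#π−1)! ∏_{B∈π} u_B`. -/
def cumulant {α K : Type*} [DecidableEq α] [CommRing K] (u : Finset α → K)
    (H : Finset α) : K :=
  ∑ π ∈ partitionsOf H,
    ((-1 : ℤ) ^ (π.card - 1) * (π.card - 1).factorial) • ∏ B ∈ π, u B

theorem mem_partitionsOf_iff {α : Type*} [DecidableEq α] {s : Finset α}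
    {π : Finset (Finset α)} :
    π ∈ partitionsOf s ↔ (∀ B ∈ π, B.Nonempty) ∧
      (∀ B ∈ π, ∀ B' ∈ π, ∀ x ∈ B, x ∈ B' → B = B') ∧ ∀ x, x ∈ s ↔ ∃ B ∈ π, x ∈ B := by
  have hsup : π.sup id = s ↔ ∀ x, x ∈ s ↔ ∃ B ∈ π, x ∈ B := by
    simp [Finset.ext_iff, Finset.mem_sup, eq_comm]
  have hdisj : (∀ B ∈ π, ∀ B' ∈ π, B ≠ B' → B ∩ B' = ∅) ↔
      ∀ B ∈ π, ∀ B' ∈ π, ∀ x ∈ B, x ∈ B' → B = B' := by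
    refine forall₄_congr fun B _ B' _ => ?_
    rw [← Finset.disjoint_iff_inter_eq_empty, Finset.disjoint_left]
    grind
  simp only [partitionsOf, Finset.mem_filter, hsup, hdisj, ← Finset.nonempty_iff_ne_empty]
  refine and_iff_right_of_imp fun h => ?_
  simp only [Finset.mem_powerset, Finset.subset_iff]
  exact fun B hB x hx => (h.2.2 x).2 ⟨B, hB, hx⟩

theorem partitionsOf_empty {α : Type*} [DecidableEq α] :
    partitionsOf (∅ : Finset α) = {∅} := by
  ext π
  simp only [mem_partitionsOf_iff, Finset.mem_singleton, Finset.notMem_empty, false_iff]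
  refine ⟨fun ⟨hne, _, h⟩ => Finset.eq_empty_of_forall_notMem fun B hB => ?_, ?_⟩
  · obtain ⟨x, hx⟩ := hne B hB
    exact h x ⟨B, hB, hx⟩
  · rintro rfl
    simp

/-- Partitions of `s` with a distinguished block `C` correspond to a nonempty subset `C` of `s`
together with a partition of `s \ C`. -/
theorem sum_partitionsOf_sum_mem {α M : Type*} [DecidableEq α] [AddCommMonoid M]
    (s : Finset α) (g : Finset α → Finset (Finset α) → M) :
    ∑ π ∈ partitionsOf s, ∑ C ∈ π, g C (π.erase C) =
      ∑ C ∈ s.powerset.erase ∅, ∑ σ ∈ partitionsOf (s \ C), g C σ := by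
  rw [Finset.sum_sigma', Finset.sum_sigma']
  refine Finset.sum_bij' (fun p _ => ⟨p.2, p.1.erase p.2⟩) (fun p _ => ⟨insert p.1 p.2, p.1⟩)
    ?_ ?_ ?_ ?_ ?_
  · rintro ⟨π, C⟩ h
    simp only [Finset.mem_sigma, mem_partitionsOf_iff, Finset.mem_erase, Finset.mem_powerset,
      Finset.mem_sdiff, ← Finset.nonempty_iff_ne_empty, Finset.subset_iff] at h ⊢
    grind
  · rintro ⟨C, σ⟩ h
    simp only [Finset.mem_sigma, mem_partitionsOf_iff, Finset.mem_erase, Finset.mem_powerset,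
      Finset.mem_sdiff, ← Finset.nonempty_iff_ne_empty, Finset.subset_iff,
      Finset.mem_insert] at h ⊢
    grind
  · rintro ⟨π, C⟩ h
    simp only [Finset.mem_sigma] at h
    simp [Finset.insert_erase h.2]
  · rintro ⟨C, σ⟩ h
    simp only [Finset.mem_sigma, mem_partitionsOf_iff, Finset.mem_erase,
      Finset.mem_sdiff, ← Finset.nonempty_iff_ne_empty] at h
    obtain ⟨⟨⟨x, hx⟩, -⟩, -, -, h⟩ := h
    have hC : C ∉ σ := fun hC => ((h x).2 ⟨C, hC, hx⟩).2 hx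
    simp [Finset.erase_insert hC]
  · rintro ⟨π, C⟩ h
    rfl

theorem exists_filter_mem_eq_singleton {α : Type*} [DecidableEq α] {s : Finset α} {a : α}
    (ha : a ∈ s) {π : Finset (Finset α)} (hπ : π ∈ partitionsOf s) :
    ∃ B ∈ π, π.filter (a ∈ ·) = {B} := by
  obtain ⟨-, hdisj, hcover⟩ := mem_partitionsOf_iff.1 hπ
  obtain ⟨B, hB, haB⟩ := (hcover a).1 ha
  refine ⟨B, hB, ?_⟩
  ext C
  simp only [Finset.mem_filter, Finset.mem_singleton]
  grind

/-- Splitting off the block which contains a given point. -/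
theorem sum_partitionsOf_prod_eq {α K : Type*} [DecidableEq α] [CommRing K]
    (f : Finset α → K) {s : Finset α} {a : α} (ha : a ∈ s) :
    ∑ π ∈ partitionsOf s, ∏ B ∈ π, f B =
      ∑ C ∈ s.powerset with a ∈ C, f C * ∑ σ ∈ partitionsOf (s \ C), ∏ B ∈ σ, f B := by
  have hfilter : s.powerset.filter (a ∈ ·) = (s.powerset.erase ∅).filter (a ∈ ·) := by
    ext C
    simp only [Finset.mem_filter, Finset.mem_erase]
    grind
  rw [hfilter, Finset.sum_filter]
  have key := sum_partitionsOf_sum_mem s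
    (fun C σ => if a ∈ C then f C * ∏ B ∈ σ, f B else 0)
  calc
    _ = ∑ π ∈ partitionsOf s, ∑ C ∈ π, if a ∈ C then f C * ∏ B ∈ π.erase C, f B else 0 := by
      refine Finset.sum_congr rfl fun π hπ => ?_
      obtain ⟨B, hB, h⟩ := exists_filter_mem_eq_singleton ha hπ
      rw [← Finset.sum_filter, h, Finset.sum_singleton, Finset.mul_prod_erase π f hB]
    _ = _ := key
    _ = _ := by
      refine Finset.sum_congr rfl fun C _ => ?_
      split_ifs
      · rw [Finset.mul_sum]
      · simp

theorem sum_partitionsOf_card_eq_one {α K : Type*} [DecidableEq α] [CommRing K]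
    (f : Finset α → K) {s : Finset α} (hs : s.Nonempty) :
    (∑ π ∈ partitionsOf s, if π.card = 1 then ∏ B ∈ π, f B else 0) = f s := by
  rw [Finset.sum_eq_single {s}]
  · simp
  · intro π hπ hne
    refine if_neg fun hcard => hne ?_
    obtain ⟨B, rfl⟩ := Finset.card_eq_one.1 hcard
    have h := (mem_partitionsOf_iff.1 hπ).2.2
    simp only [Finset.mem_singleton, exists_eq_left] at h
    rw [Finset.ext h]
  · intro h
    refine absurd (mem_partitionsOf_iff.2 ?_) h
    simp only [Finset.mem_singleton]
    grind

/-- The alternating factorial weights of partitions of size `k` and `k - 1` cancel, except for the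
one-block partition. -/
theorem neg_one_pow_mul_factorial_add {k : ℕ} (hk : k ≠ 0) :
    (-1 : ℤ) ^ (k - 1) * (k - 1).factorial +
      (k - 1 : ℕ) * ((-1 : ℤ) ^ (k - 1 - 1) * (k - 1 - 1).factorial) =
        if k = 1 then 1 else 0 := by
  obtain _ | _ | k := k
  · contradiction
  · simp
  · simp [Nat.factorial_succ, pow_succ]
    ring

theorem sum_cumulant_mul_eq {α K : Type*} [DecidableEq α] [CommRing K]
    (u : Finset α → K) {s : Finset α} {a : α} (ha : a ∈ s) :
    (∑ C ∈ s.powerset with a ∈ C, cumulant u C * if s \ C = ∅ then 1 else u (s \ C)) = u s := by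
  have hcompl : (∑ C ∈ s.powerset with a ∈ C,
      cumulant u C * if s \ C = ∅ then 1 else u (s \ C)) =
      ∑ C ∈ s.powerset with a ∉ C, cumulant u (s \ C) * if C = ∅ then 1 else u C := by
    refine Finset.sum_nbij' (s \ ·) (s \ ·) ?_ ?_ ?_ ?_ ?_ <;> intro C hC <;>
      simp only [Finset.mem_filter, Finset.mem_powerset] at hC
    · simp [hC.2]
    · simp [hC.2, ha]
    · exact Finset.sdiff_sdiff_eq_self hC.1
    · exact Finset.sdiff_sdiff_eq_self hC.1
    · simp only [Finset.sdiff_sdiff_eq_self hC.1]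
  have hrest : (∑ C ∈ s.powerset.erase ∅,
      if a ∉ C then cumulant u (s \ C) * (if C = ∅ then 1 else u C) else 0) =
      ∑ π ∈ partitionsOf s, ((π.card - 1 : ℕ) *
        ((-1 : ℤ) ^ (π.card - 1 - 1) * (π.card - 1 - 1).factorial)) • ∏ B ∈ π, u B := by
    have key := sum_partitionsOf_sum_mem s fun C σ => if a ∉ C then
      ((-1 : ℤ) ^ (σ.card - 1) * (σ.card - 1).factorial) • (u C * ∏ B ∈ σ, u B) else 0
    calc
      _ = _ := by
        refine Finset.sum_congr rfl fun C hC => ?_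
        rw [if_neg (Finset.mem_erase.1 hC).1]
        split_ifs
        · simp
        · rw [cumulant, Finset.sum_mul]
          refine Finset.sum_congr rfl fun σ _ => ?_
          rw [smul_mul_assoc, mul_comm (u C)]
      _ = _ := key.symm
      _ = _ := by
        refine Finset.sum_congr rfl fun π hπ => ?_
        obtain ⟨B, hB, h⟩ := exists_filter_mem_eq_singleton ha hπ
        have hcard : (π.filter (a ∉ ·)).card = π.card - 1 := by
          have := Finset.card_filter_add_card_filter_not (s := π) (a ∈ ·)
          rw [h, Finset.card_singleton] at this
          omega
        rw [← Finset.sum_filter, mul_smul, Nat.cast_smul_eq_nsmul, ← hcard, ← Finset.sum_const]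
        refine Finset.sum_congr rfl fun C hC => ?_
        have hCπ := (Finset.mem_filter.1 hC).1
        rw [Finset.mul_prod_erase π u hCπ, Finset.card_erase_of_mem hCπ, hcard]
  rw [hcompl, Finset.sum_filter, ← Finset.add_sum_erase _ _ (Finset.empty_mem_powerset s), hrest]
  simp only [Finset.notMem_empty, not_false_eq_true, if_true, Finset.sdiff_empty, mul_one]
  rw [cumulant, ← Finset.sum_add_distrib, ← sum_partitionsOf_card_eq_one u ⟨a, ha⟩]
  refine Finset.sum_congr rfl fun π hπ => ?_
  obtain ⟨B, hB, -⟩ := exists_filter_mem_eq_singleton ha hπ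
  rw [← add_smul, neg_one_pow_mul_factorial_add (Finset.card_ne_zero_of_mem hB)]
  split_ifs <;> simp

/-- moment–cumulant inversion: for every nonempty subset `H` of a finite
set `S`, `u_H = Σ_{π ∈ P(H)} ∏_{B∈π} κ_B(u)`. -/
theorem moment_cumulant_inversion {α K : Type*} [DecidableEq α] [CommRing K]
    (S : Finset α) (u : Finset α → K) (H : Finset α) (hHS : H ⊆ S) (hH : H.Nonempty) :
    u H = ∑ π ∈ partitionsOf H, ∏ B ∈ π, cumulant u B := by
  clear hHS
  induction H using Finset.strongInduction with
  | H H ih =>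
    obtain ⟨a, ha⟩ := hH
    rw [sum_partitionsOf_prod_eq (cumulant u) ha, ← sum_cumulant_mul_eq u ha]
    refine Finset.sum_congr rfl fun C hC => ?_
    obtain ⟨hCH, haC⟩ := Finset.mem_filter.1 hC
    split_ifs with h
    · simp [h, partitionsOf_empty]
    · have hlt : H \ C ⊂ H := Finset.sdiff_ssubset (Finset.mem_powerset.1 hCH) ⟨a, haC⟩
      rw [ih _ hlt (Finset.nonempty_iff_ne_empty.2 h)]
end

section
/- Let F be a field, c ∈ F, r a positive integer, and let (u_I)_{I ⊆ [r]} be a family of nonzero rational functions in F(q) with u_∅ = 1. Then the following two statements are equivalent: (I) strong factorization property at q = c: for every subset H ⊆ [r] with |H| ≥ 2, T_H(u) = O_c((q−c)^{|H|−1}); (II) small cumulant property at q = c: for every subset H ⊆ [r] with |H| ≥ 2, κ_H(u)/(∏_{h∈H} u_{{h}}) = O_c((q−c)^{|H|−1}). -/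
/-- `f = O_c(g)`: the rational function `f/g` has no pole at `q = c`. -/
def IsOAt {F : Type*} [Field F] (c : F) (f g : RatFunc F) : Prop :=
  ∃ a b : Polynomial F, Polynomial.eval c b ≠ 0 ∧
    f * algebraMap (Polynomial F) (RatFunc F) b =
      g * algebraMap (Polynomial F) (RatFunc F) a

/-- The cumulative factorization error term
`T_H(u) = (∏_{G ⊆ H} u_G^{(−1)^{|H|−|G|}}) − 1`. -/
def Tfun {α F : Type*} [DecidableEq α] [Field F] (u : Finset α → F) (H : Finset α) : F :=
  (∏ G ∈ H.powerset, u G ^ ((-1 : ℤ) ^ (H.card - G.card))) - 1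

section Partitions

variable {α β : Type*} [DecidableEq α] [DecidableEq β]

theorem mem_partitionsOf {s : Finset α} {π : Finset (Finset α)} :
    π ∈ partitionsOf s ↔ (∀ B ∈ π, B.Nonempty) ∧ (∀ B ∈ π, B ⊆ s) ∧
      (∀ B ∈ π, ∀ B' ∈ π, ∀ x ∈ B, x ∈ B' → B = B') ∧ ∀ x ∈ s, ∃ B ∈ π, x ∈ B := by
  simp only [partitionsOf, Finset.mem_filter, Finset.mem_powerset,
    ← Finset.nonempty_iff_ne_empty]
  constructor
  · rintro ⟨h1, h2, h3, h4⟩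
    refine ⟨h2, fun B hB => Finset.mem_powerset.1 (h1 hB), fun B hB B' hB' x hx hx' => ?_,
      fun x hx => ?_⟩
    · by_contra hne
      have := h3 B hB B' hB' hne
      have hm := Finset.mem_inter.2 ⟨hx, hx'⟩
      simp [this] at hm
    · rw [← h4] at hx
      simpa [Finset.mem_sup] using hx
  · rintro ⟨h1, h2, h3, h4⟩
    refine ⟨fun B hB => Finset.mem_powerset.2 (h2 B hB), h1, fun B hB B' hB' hne => ?_, ?_⟩
    · ext x
      simp only [Finset.mem_inter, Finset.notMem_empty, iff_false]
      exact fun hx => hne (h3 B hB B' hB' x hx.1 hx.2)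
    · ext x
      simp only [Finset.mem_sup, id]
      exact ⟨fun ⟨B, hB, hx⟩ => h2 B hB hx, h4 x⟩

theorem prod_prod_of_mem_partitionsOf {K : Type*} [CommMonoid K] {s : Finset α}
    {π : Finset (Finset α)} (hπ : π ∈ partitionsOf s) (g : α → K) :
    ∏ B ∈ π, ∏ x ∈ B, g x = ∏ x ∈ s, g x := by
  obtain ⟨h1, h2, h3, h4⟩ := mem_partitionsOf.1 hπ
  have hs : s = π.biUnion id := by
    ext x
    simp only [Finset.mem_biUnion, id]
    exact ⟨h4 x, fun ⟨B, hB, hx⟩ => h2 B hB hx⟩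
  rw [hs, Finset.prod_biUnion]
  · rfl
  · intro B hB B' hB' hne
    rw [Function.onFun, Finset.disjoint_left]
    exact fun x hx hx' => hne (h3 B hB B' hB' x hx hx')

theorem card_pos_of_mem_partitionsOf {s : Finset α} (hs : s.Nonempty)
    {π : Finset (Finset α)} (hπ : π ∈ partitionsOf s) : 0 < π.card := by
  obtain ⟨x, hx⟩ := hs
  obtain ⟨B, hB, -⟩ := (mem_partitionsOf.1 hπ).2.2.2 x hx
  exact Finset.card_pos.2 ⟨B, hB⟩

theorem singleton_mem_partitionsOf {s : Finset α} (hs : s.Nonempty) :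
    {s} ∈ partitionsOf s := by
  rw [mem_partitionsOf]
  grind

theorem eq_singleton_of_mem_partitionsOf {s : Finset α}
    {π : Finset (Finset α)} (hπ : π ∈ partitionsOf s) (h : s ∈ π) : π = {s} := by
  obtain ⟨h1, h2, h3, h4⟩ := mem_partitionsOf.1 hπ
  ext B
  rw [Finset.mem_singleton]
  refine ⟨fun hB => ?_, fun hB => hB ▸ h⟩
  obtain ⟨x, hx⟩ := h1 B hB
  exact h3 B hB s h x hx (h2 B hB hx)

theorem sum_partitionsOf_comap {M R : Type*} [AddCommMonoid M] [CommMonoid R] (f : α → β)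
    (V : Finset α) (φ : ℕ → R → M) (u : Finset α → R) :
    ∑ π ∈ partitionsOf V with ∀ B ∈ π, ∀ x ∈ B, ∀ y ∈ V, f x = f y → y ∈ B,
        φ π.card (∏ B ∈ π, u B) =
      ∑ π ∈ partitionsOf (V.image f), φ π.card (∏ B ∈ π, u (V.filter (f · ∈ B))) := by
  symm
  have key : ∀ B ⊆ V.image f, (V.filter (f · ∈ B)).image f = B := by
    intro B hB
    ext y
    simp only [Finset.mem_image, Finset.mem_filter]
    constructor
    · rintro ⟨x, ⟨-, hx⟩, rfl⟩
      exact hx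
    · intro hy
      obtain ⟨x, hx, rfl⟩ := Finset.mem_image.1 (hB hy)
      exact ⟨x, ⟨hx, hy⟩, rfl⟩
  refine Finset.sum_bij' (fun π _ => π.image fun B => V.filter (f · ∈ B))
    (fun π _ => π.image fun B => B.image f) ?_ ?_ ?_ ?_ ?_
  · intro π hπ
    obtain ⟨h1, h2, h3, h4⟩ := mem_partitionsOf.1 hπ
    rw [Finset.mem_filter, mem_partitionsOf]
    simp only [Finset.forall_mem_image, Finset.exists_mem_image, Finset.mem_filter] at *
    refine ⟨⟨?_, ?_, ?_, ?_⟩, ?_⟩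
    · intro B hB
      have := key B (h2 B hB)
      rw [← Finset.image_nonempty (f := f), this]
      exact h1 B hB
    · exact fun B hB => Finset.filter_subset _ _
    · intro B hB B' hB' x hx hx'
      rw [h3 B hB B' hB' _ hx.2 hx'.2]
    · intro x hx
      obtain ⟨B, hB, h⟩ := h4 hx
      exact ⟨B, hB, hx, h⟩
    · intro B hB x hx y hy hxy
      exact ⟨hy, hxy ▸ hx.2⟩
  · intro π hπ
    rw [Finset.mem_filter] at hπ
    obtain ⟨hπ, hf⟩ := hπ
    obtain ⟨h1, h2, h3, h4⟩ := mem_partitionsOf.1 hπ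
    rw [mem_partitionsOf]
    simp only [Finset.forall_mem_image, Finset.exists_mem_image] at *
    refine ⟨?_, ?_, ?_, ?_⟩
    · exact fun B hB => (h1 B hB).image f
    · exact fun B hB => Finset.image_subset_image (h2 B hB)
    · intro B hB B' hB' x hx hx'
      obtain ⟨y, hy, hxy⟩ := Finset.mem_image.1 hx'
      rw [h3 B hB B' hB' x hx (hf B' hB' y hy x (h2 B hB hx) hxy)]
    · intro x hx
      obtain ⟨B, hB, h⟩ := h4 x hx
      exact ⟨B, hB, Finset.mem_image_of_mem f h⟩
  · intro π hπ
    obtain ⟨h1, h2, h3, h4⟩ := mem_partitionsOf.1 hπ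
    simp only [Finset.image_image]
    conv_rhs => rw [← Finset.image_id (s := π)]
    exact Finset.image_congr fun B hB => key B (h2 B hB)
  · intro π hπ
    rw [Finset.mem_filter] at hπ
    obtain ⟨hπ, hf⟩ := hπ
    obtain ⟨h1, h2, h3, h4⟩ := mem_partitionsOf.1 hπ
    simp only [Finset.image_image]
    conv_rhs => rw [← Finset.image_id (s := π)]
    refine Finset.image_congr fun B hB => ?_
    ext x
    simp only [Function.comp, Finset.mem_filter, Finset.mem_image, id]
    constructor
    · rintro ⟨hx, y, hy, hyx⟩
      exact hf B hB y hy x hx hyx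
    · exact fun hx => ⟨h2 B hB hx, x, hx, rfl⟩
  · intro π hπ
    obtain ⟨h1, h2, h3, h4⟩ := mem_partitionsOf.1 hπ
    have hinj : Set.InjOn (fun B => V.filter (f · ∈ B)) (π : Set (Finset β)) := by
      intro B hB B' hB' h
      rw [← key B (h2 B hB), ← key B' (h2 B' hB')]
      exact congrArg (Finset.image f) h
    rw [Finset.card_image_of_injOn hinj, Finset.prod_image hinj]

theorem sum_partitionsOf_insert {M : Type*} [AddCommMonoid M] {x : α} {V : Finset α}
    (hx : x ∉ V) (φ : ℕ → M) :
    ∑ π ∈ partitionsOf (insert x V), φ π.card =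
      ∑ π ∈ partitionsOf V, (φ (π.card + 1) + π.card • φ π.card) := by
  rw [← Finset.sum_filter_add_sum_filter_not _ (fun π => {x} ∈ π), Finset.sum_add_distrib]
  congr 1
  · refine Finset.sum_bij' (fun π _ => π.erase {x}) (fun π _ => insert {x} π) ?_ ?_ ?_ ?_ ?_
    · intro π hπ
      rw [Finset.mem_filter, mem_partitionsOf] at hπ
      rw [mem_partitionsOf]
      obtain ⟨⟨h1, h2, h3, h4⟩, h5⟩ := hπ
      refine ⟨by grind, ?_, by grind, by grind⟩
      intro B hB y hy
      have hB' := Finset.mem_erase.1 hB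
      have := h3 B hB'.2 {x} h5
      grind
    · intro π hπ
      rw [mem_partitionsOf] at hπ
      rw [Finset.mem_filter, mem_partitionsOf]
      grind
    · intro π hπ
      exact Finset.insert_erase (Finset.mem_filter.1 hπ).2
    · intro π hπ
      rw [mem_partitionsOf] at hπ
      refine Finset.erase_insert fun h => hx (hπ.2.1 _ h (Finset.mem_singleton_self x))
    · intro π hπ
      rw [Finset.card_erase_add_one (Finset.mem_filter.1 hπ).2]
  · simp_rw [← Finset.sum_const]
    rw [Finset.sum_sigma']
    symm
    refine Finset.sum_bij (fun p _ => insert (insert x p.2) (p.1.erase p.2)) ?_ ?_ ?_ ?_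
    · rintro ⟨π, B⟩ hp
      rw [Finset.mem_sigma, mem_partitionsOf] at hp
      rw [Finset.mem_filter, mem_partitionsOf]
      dsimp only at *
      obtain ⟨⟨h1, h2, h3, h4⟩, hB⟩ := hp
      refine ⟨⟨by grind, by grind, by grind, ?_⟩, ?_⟩
      · intro y hy
        by_cases hyB : y ∈ insert x B
        · exact ⟨_, Finset.mem_insert_self _ _, hyB⟩
        · obtain ⟨B', hB', hy'⟩ := h4 y (by grind)
          exact ⟨B', by grind, hy'⟩
      · have := h1 B hB
        grind
    · rintro ⟨π, B⟩ hp ⟨π', B'⟩ hp' h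
      rw [Finset.mem_sigma, mem_partitionsOf] at hp hp'
      dsimp only at *
      obtain ⟨⟨-, h2, -, -⟩, hB⟩ := hp
      obtain ⟨⟨-, h2', -, -⟩, hB'⟩ := hp'
      have hxB : ∀ C ∈ π, x ∉ C := fun C hC hxC => hx (h2 C hC hxC)
      have hxB' : ∀ C ∈ π', x ∉ C := fun C hC hxC => hx (h2' C hC hxC)
      have hBB : insert x B = insert x B' := by
        have hm : insert x B ∈ insert (insert x B') (π'.erase B') :=
          h ▸ Finset.mem_insert_self _ _
        rcases Finset.mem_insert.1 hm with hm | hm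
        · exact hm
        · exact absurd (Finset.mem_insert_self x B) (hxB' _ (Finset.mem_of_mem_erase hm))
      have hBB' : B = B' := by
        rw [← Finset.erase_insert (hxB B hB), hBB, Finset.erase_insert (hxB' B' hB')]
      subst hBB'
      have hn : insert x B ∉ π.erase B := fun hm =>
        hxB _ (Finset.mem_of_mem_erase hm) (Finset.mem_insert_self x B)
      have hn' : insert x B ∉ π'.erase B := fun hm =>
        hxB' _ (Finset.mem_of_mem_erase hm) (Finset.mem_insert_self x B)
      have he : π.erase B = π'.erase B := by
        rw [← Finset.erase_insert hn, h, Finset.erase_insert hn']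
      have hππ : π = π' := by
        rw [← Finset.insert_erase hB, he, Finset.insert_erase hB']
      rw [hππ]
    · intro ρ hρ
      rw [Finset.mem_filter, mem_partitionsOf] at hρ
      obtain ⟨⟨h1, h2, h3, h4⟩, h5⟩ := hρ
      obtain ⟨A, hA, hxA⟩ := h4 x (Finset.mem_insert_self x V)
      have hmem : ∀ C ∈ ρ, ∀ y ∈ C, y ∈ A → C = A := fun C hC y hy hyA => h3 C hC A hA y hy hyA
      have hAn : (A.erase x).Nonempty := by
        rw [Finset.nonempty_iff_ne_empty]
        intro he
        rcases Finset.erase_eq_empty_iff A x |>.1 he with he | he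
        · exact absurd (h1 A hA) (by simp [he])
        · exact h5 (he ▸ hA)
      have hnot : A.erase x ∉ ρ.erase A := by
        intro hm
        obtain ⟨y, hy⟩ := hAn
        exact (Finset.mem_erase.1 hm).1
          (hmem _ (Finset.mem_of_mem_erase hm) y hy (Finset.mem_of_mem_erase hy))
      refine ⟨⟨insert (A.erase x) (ρ.erase A), A.erase x⟩, ?_, ?_⟩
      · rw [Finset.mem_sigma, mem_partitionsOf]
        refine ⟨⟨by grind, ?_, by grind, ?_⟩, Finset.mem_insert_self _ _⟩
        · intro C hC y hy
          have := h2 A hA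
          have h6 : ∀ C ∈ ρ, x ∈ C → C = A := fun C hC hxC => hmem C hC x hxC hxA
          grind
        · intro y hy
          by_cases hyA : y ∈ A.erase x
          · exact ⟨_, Finset.mem_insert_self _ _, hyA⟩
          · obtain ⟨C, hC, hyC⟩ := h4 y (Finset.mem_insert_of_mem hy)
            exact ⟨C, by grind, hyC⟩
      · dsimp only
        rw [Finset.insert_erase hxA, Finset.erase_insert hnot, Finset.insert_erase hA]
    · rintro ⟨π, B⟩ hp
      rw [Finset.mem_sigma, mem_partitionsOf] at hp
      dsimp only at *
      obtain ⟨⟨h1, h2, h3, h4⟩, hB⟩ := hp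
      rw [Finset.card_insert_of_notMem, Finset.card_erase_add_one hB]
      grind

end Partitions

section Cumulants

variable {α β ι K : Type*} [DecidableEq α] [DecidableEq β] [Field K]

theorem cumulant_congr {u v : Finset α → K} {H : Finset α}
    (h : ∀ B ⊆ H, B.Nonempty → u B = v B) : cumulant u H = cumulant v H := by
  refine Finset.sum_congr rfl fun π hπ => ?_
  obtain ⟨h1, h2, -, -⟩ := mem_partitionsOf.1 hπ
  rw [Finset.prod_congr rfl fun B hB => h B (h2 B hB) (h1 B hB)]

theorem cumulant_mul_prod (u : Finset α → K) (g : α → K) (H : Finset α) :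
    cumulant (fun B => u B * ∏ h ∈ B, g h) H = cumulant u H * ∏ h ∈ H, g h := by
  rw [cumulant, cumulant, Finset.sum_mul]
  refine Finset.sum_congr rfl fun π hπ => ?_
  rw [Finset.prod_mul_distrib, prod_prod_of_mem_partitionsOf hπ, smul_mul_assoc]

theorem cumulant_sub_cumulant {u v : Finset α → K} {H : Finset α} (hH : H.Nonempty)
    (h : ∀ B ⊂ H, B.Nonempty → u B = v B) :
    cumulant u H - cumulant v H = u H - v H := by
  rw [cumulant, cumulant, ← Finset.sum_sub_distrib,
    Finset.sum_eq_single_of_mem _ (singleton_mem_partitionsOf hH)]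
  · simp
  · intro π hπ hne
    obtain ⟨h1, h2, -, -⟩ := mem_partitionsOf.1 hπ
    rw [Finset.prod_congr rfl fun B hB => h B ((h2 B hB).ssubset_of_ne fun he =>
      hne (eq_singleton_of_mem_partitionsOf hπ (he ▸ hB))) (h1 B hB), sub_self]

theorem cumulant_one {H : Finset α} (hH : 2 ≤ H.card) :
    cumulant (fun _ => (1 : K)) H = 0 := by
  obtain ⟨x, hx⟩ := Finset.card_pos.1 (show 0 < H.card by omega)
  have hcard := Finset.card_erase_of_mem hx
  have hne : (H.erase x).Nonempty := Finset.card_pos.1 (by omega)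
  simp only [cumulant, Finset.prod_const_one]
  rw [← Finset.insert_erase hx]
  rw [sum_partitionsOf_insert (Finset.notMem_erase x H)
    (fun k => ((-1 : ℤ) ^ (k - 1) * (k - 1).factorial) • (1 : K))]
  refine Finset.sum_eq_zero fun π hπ => ?_
  obtain ⟨k, hk⟩ := Nat.exists_eq_succ_of_ne_zero (card_pos_of_mem_partitionsOf hne hπ).ne'
  rw [hk]
  simp only [Nat.succ_eq_add_one, Nat.add_sub_cancel, Nat.factorial_succ, pow_succ]
  simp
  ring

/-- The multiplicative function on sets in which a set picks up the factor `1 + T e` for each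
hyperedge `G e`, `e ∈ E`, that it contains. -/
def edgeWeight (E : Finset ι) (G : ι → Finset α) (T : ι → K) (I : Finset α) : K :=
  ∏ e ∈ E, if G e ⊆ I then 1 + T e else 1

theorem prod_edge_of_mem_partitionsOf {V g : Finset α} (hg : g.Nonempty)
    {π : Finset (Finset α)} (hπ : π ∈ partitionsOf V) (a : K) [Decidable (∃ B ∈ π, g ⊆ B)] :
    ∏ B ∈ π, (if g ⊆ B then a else 1) = if ∃ B ∈ π, g ⊆ B then a else 1 := by
  obtain ⟨x, hx⟩ := hg
  obtain ⟨h1, h2, h3, h4⟩ := mem_partitionsOf.1 hπ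
  split_ifs with h
  · obtain ⟨A, hA, hgA⟩ := h
    rw [Finset.prod_eq_single_of_mem A hA, if_pos hgA]
    intro B hB hne
    exact if_neg fun hgB => hne (h3 B hB A hA x (hgB hx) (hgA hx))
  · exact Finset.prod_eq_one fun B hB => if_neg fun hgB => h ⟨B, hB, hgB⟩

theorem cumulant_mul_edge (u : Finset α → K) {V g : Finset α} {x₀ : α} (hx₀ : x₀ ∈ g)
    (hgV : g ⊆ V) (f : α → α) (hf : ∀ x, f x = if x ∈ g then x₀ else x) (a : K) :
    cumulant (fun B => (if g ⊆ B then 1 + a else 1) * u B) V =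
      cumulant u V + a * cumulant (fun B => u (V.filter (f · ∈ B))) (V.image f) := by
  classical
  have h := sum_partitionsOf_comap f V
    (fun k (y : K) => ((-1 : ℤ) ^ (k - 1) * (k - 1).factorial) • y) u
  rw [cumulant, cumulant, cumulant, ← h, Finset.sum_filter, Finset.mul_sum,
    ← Finset.sum_add_distrib]
  refine Finset.sum_congr rfl fun π hπ => ?_
  rw [Finset.prod_mul_distrib, prod_edge_of_mem_partitionsOf ⟨x₀, hx₀⟩ hπ]
  obtain ⟨h1, h2, h3, h4⟩ := mem_partitionsOf.1 hπ
  have hiff : (∃ B ∈ π, g ⊆ B) ↔ ∀ B ∈ π, ∀ x ∈ B, ∀ y ∈ V, f x = f y → y ∈ B := by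
    constructor
    · rintro ⟨A, hA, hgA⟩ B hB x hx y hy hxy
      rw [hf, hf] at hxy
      have h6 := h3 A hA B hB x
      grind
    · intro hc
      obtain ⟨B, hB, hxB⟩ := h4 x₀ (hgV hx₀)
      refine ⟨B, hB, fun y hy => hc B hB x₀ hxB y (hgV hy) ?_⟩
      rw [hf, hf, if_pos hx₀, if_pos hy]
  simp only [hiff]
  split_ifs
  · simp only [zsmul_eq_mul]
    ring
  · simp

theorem edgeWeight_contract (E : Finset ι) {G : ι → Finset α} (T : ι → K) {V : Finset α}
    (hG : ∀ e ∈ E, G e ⊆ V) (f : α → β) (B : Finset β) :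
    edgeWeight E G T (V.filter (f · ∈ B)) = edgeWeight E (fun e => (G e).image f) T B := by
  refine Finset.prod_congr rfl fun e he => ?_
  have : G e ⊆ V.filter (f · ∈ B) ↔ (G e).image f ⊆ B := by
    rw [Finset.image_subset_iff]
    refine ⟨fun h x hx => (Finset.mem_filter.1 (h hx)).2, fun h x hx => ?_⟩
    exact Finset.mem_filter.2 ⟨hG e he hx, h x hx⟩
  simp only [this]

/-- `x` is `t ^ n` times an element of the subring `R`. -/
def DivByPow (R : Subring K) (t : K) (n : ℕ) (x : K) : Prop :=
  ∃ y ∈ R, x = t ^ n * y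

namespace DivByPow

variable {R : Subring K} {t x y : K} {m n : ℕ}

theorem zero : DivByPow R t n 0 := ⟨0, R.zero_mem, by simp⟩

theorem add (hx : DivByPow R t n x) (hy : DivByPow R t n y) : DivByPow R t n (x + y) := by
  obtain ⟨a, ha, rfl⟩ := hx
  obtain ⟨b, hb, rfl⟩ := hy
  exact ⟨a + b, R.add_mem ha hb, by ring⟩

theorem sub (hx : DivByPow R t n x) (hy : DivByPow R t n y) : DivByPow R t n (x - y) := by
  obtain ⟨a, ha, rfl⟩ := hx
  obtain ⟨b, hb, rfl⟩ := hy
  exact ⟨a - b, R.sub_mem ha hb, by ring⟩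

theorem mul (hx : DivByPow R t m x) (hy : DivByPow R t n y) :
    DivByPow R t (m + n) (x * y) := by
  obtain ⟨a, ha, rfl⟩ := hx
  obtain ⟨b, hb, rfl⟩ := hy
  exact ⟨a * b, R.mul_mem ha hb, by ring⟩

theorem mul_mem (hx : DivByPow R t n x) (hy : y ∈ R) : DivByPow R t n (x * y) := by
  obtain ⟨a, ha, rfl⟩ := hx
  exact ⟨a * y, R.mul_mem ha hy, by ring⟩

theorem mono (ht : t ∈ R) (hmn : m ≤ n) (hx : DivByPow R t n x) : DivByPow R t m x := by
  obtain ⟨a, ha, rfl⟩ := hx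
  refine ⟨t ^ (n - m) * a, R.mul_mem (R.pow_mem ht _) ha, ?_⟩
  rw [← mul_assoc, ← pow_add, Nat.add_sub_cancel' hmn]

end DivByPow

theorem DivByPow.cumulant_edgeWeight {R : Subring K} {t : K} (ht : t ∈ R) (E : Finset ι)
    (T : ι → K) : ∀ (V : Finset α) (G : ι → Finset α), V.Nonempty →
      (∀ e ∈ E, (G e).Nonempty ∧ G e ⊆ V ∧ DivByPow R t ((G e).card - 1) (T e)) →
      DivByPow R t (V.card - 1) (cumulant (edgeWeight E G T) V) := by
  classical
  induction E using Finset.induction_on with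
  | empty =>
    intro V G hV _
    have he : (edgeWeight ∅ G T : Finset α → K) = fun _ => 1 := rfl
    rw [he]
    rcases Nat.lt_or_ge V.card 2 with h | h
    · obtain ⟨x, rfl⟩ := Finset.card_eq_one.1
        (show V.card = 1 by have := hV.card_pos; omega)
      refine ⟨cumulant (fun _ => (1 : K)) {x}, ?_, by simp⟩
      refine R.sum_mem fun π _ => R.zsmul_mem ?_ _
      simp [R.one_mem]
    · rw [cumulant_one h]
      exact .zero
  | insert e₀ E he₀ ih =>
    intro V G hV hE
    obtain ⟨⟨x₀, hx₀⟩, hgV, hT⟩ := hE e₀ (Finset.mem_insert_self _ _)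
    have hE' : ∀ e ∈ E, _ := fun e he => hE e (Finset.mem_insert_of_mem he)
    let f : α → α := fun x => if x ∈ G e₀ then x₀ else x
    have hw : (edgeWeight (insert e₀ E) G T : Finset α → K) =
        fun B => (if G e₀ ⊆ B then 1 + T e₀ else 1) * edgeWeight E G T B :=
      funext fun B => Finset.prod_insert he₀
    rw [hw, cumulant_mul_edge _ hx₀ hgV f (fun _ => rfl)]
    refine (ih V G hV hE').add ?_
    simp only [edgeWeight_contract E T (fun e he => (hE' e he).2.1)]
    refine (hT.mul (ih (V.image f) _ (hV.image f) fun e he => ?_)).mono ht ?_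
    · obtain ⟨h1, h2, h3⟩ := hE' e he
      exact ⟨h1.image f, Finset.image_subset_image h2,
        h3.mono ht (Nat.sub_le_sub_right Finset.card_image_le 1)⟩
    · have hsub : insert x₀ (V \ G e₀) ⊆ V.image f := by
        intro y hy
        rw [Finset.mem_image]
        rcases Finset.mem_insert.1 hy with rfl | hy
        · exact ⟨y, hgV hx₀, if_pos hx₀⟩
        · rw [Finset.mem_sdiff] at hy
          exact ⟨y, hy.1, if_neg hy.2⟩
      have h1 := Finset.card_le_card hsub
      rw [Finset.card_insert_of_notMem (by simp [hx₀]), Finset.card_sdiff_of_subset hgV] at h1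
      have h2 := Finset.card_pos.2 ⟨x₀, hx₀⟩
      have h3 := Finset.card_le_card hgV
      omega

end Cumulants

section Factorization

variable {α K : Type*} [DecidableEq α] [Field K]

theorem one_add_Tfun (u : Finset α → K) (H : Finset α) :
    1 + Tfun u H = ∏ G ∈ H.powerset, u G ^ ((-1 : ℤ) ^ (H.card - G.card)) := by
  rw [Tfun, add_sub_cancel]

theorem one_add_Tfun_ne_zero {u : Finset α → K} (hu : ∀ I, u I ≠ 0) (H : Finset α) :
    1 + Tfun u H ≠ 0 := by
  rw [one_add_Tfun]
  exact Finset.prod_ne_zero_iff.2 fun G _ => zpow_ne_zero _ (hu G)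

theorem one_add_Tfun_insert (u : Finset α → K) {x : α} {H : Finset α} (hx : x ∉ H) :
    1 + Tfun u (insert x H) = (1 + Tfun (fun I => u (insert x I)) H) / (1 + Tfun u H) := by
  rw [one_add_Tfun, one_add_Tfun, one_add_Tfun, Finset.prod_powerset_insert hx, div_eq_mul_inv,
    mul_comm, ← Finset.prod_inv_distrib]
  congr 1
  · refine Finset.prod_congr rfl fun G hG => ?_
    have hGH := Finset.mem_powerset.1 hG
    rw [Finset.card_insert_of_notMem hx, Finset.card_insert_of_notMem fun h => hx (hGH h),
      Nat.add_sub_add_right]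
  · refine Finset.prod_congr rfl fun G hG => ?_
    have hGH := Finset.card_le_card (Finset.mem_powerset.1 hG)
    rw [Finset.card_insert_of_notMem hx, Nat.sub_add_comm hGH, pow_succ, mul_neg_one, zpow_neg]

theorem prod_powerset_one_add_Tfun (H : Finset α) : ∀ {u : Finset α → K}, (∀ I, u I ≠ 0) →
    ∏ G ∈ H.powerset, (1 + Tfun u G) = u H := by
  induction H using Finset.induction_on with
  | empty =>
    intro u hu
    simp [Tfun]
  | insert x H hx ih =>
    intro u hu
    rw [Finset.prod_powerset_insert hx, ← Finset.prod_mul_distrib,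
      ← ih (u := fun I => u (insert x I)) fun I => hu _]
    refine Finset.prod_congr rfl fun G hG => ?_
    rw [one_add_Tfun_insert u fun h => hx (Finset.mem_powerset.1 hG h),
      mul_div_cancel₀ _ (one_add_Tfun_ne_zero hu G)]

theorem prod_powerset_two_le_card {u : Finset α → K} (hu : ∀ I, u I ≠ 0) (h0 : u ∅ = 1)
    (H : Finset α) :
    u H = (∏ G ∈ H.powerset with 2 ≤ G.card, (1 + Tfun u G)) * ∏ h ∈ H, u {h} := by
  rw [← prod_powerset_one_add_Tfun H hu,
    ← Finset.prod_filter_mul_prod_filter_not H.powerset (fun G => 2 ≤ G.card)]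
  congr 1
  have hs : (H.powerset.filter fun G => ¬ 2 ≤ G.card) =
      insert ∅ (H.map ⟨fun h => {h}, Finset.singleton_injective⟩) := by
    ext G
    simp only [Finset.mem_filter, Finset.mem_powerset, Finset.mem_insert, Finset.mem_map,
      Function.Embedding.coeFn_mk, not_le, Nat.lt_succ_iff]
    constructor
    · rintro ⟨hG, hc⟩
      rcases G.eq_empty_or_nonempty with h | ⟨x, hx⟩
      · exact Or.inl h
      · refine Or.inr ⟨x, hG hx, ?_⟩
        have hc' := Finset.card_le_one.1 (show G.card ≤ 1 by omega)
        ext y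
        rw [Finset.mem_singleton]
        exact ⟨fun h => h ▸ hx, fun hy => hc' y hy x hx⟩
    · rintro (rfl | ⟨x, hx, rfl⟩)
      · simp
      · simp [hx]
  rw [hs, Finset.prod_insert (by simp), Finset.prod_map]
  have hx : ∀ x, 1 + Tfun u {x} = u {x} := by
    intro x
    rw [← insert_empty_eq, one_add_Tfun_insert u (Finset.notMem_empty x)]
    simp [Tfun, h0]
  have he : 1 + Tfun u ∅ = 1 := by simp [Tfun, h0]
  simp [hx, he]

theorem exists_unit_cumulant_sub_mul_Tfun {R : Subring K} {t : K} (ht : t ∈ R)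
    (hunit : ∀ y ∈ R, (1 + t * y)⁻¹ ∈ R) {u : Finset α → K} (hu : ∀ I, u I ≠ 0) (h0 : u ∅ = 1)
    {H : Finset α} (hH : 2 ≤ H.card)
    (hT : ∀ G ⊂ H, 2 ≤ G.card → DivByPow R t (G.card - 1) (Tfun u G)) :
    ∃ W : K, W ≠ 0 ∧ W ∈ R ∧ W⁻¹ ∈ R ∧
      DivByPow R t (H.card - 1) (cumulant u H / (∏ h ∈ H, u {h}) - W * Tfun u H) := by
  have hne : H.Nonempty := Finset.card_pos.1 (by omega)
  set E := H.ssubsets.filter fun G => 2 ≤ G.card with hEdef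
  set v : Finset α → K := fun I => ∏ G ∈ I.powerset with 2 ≤ G.card, (1 + Tfun u G) with hv
  have hE : ∀ G ∈ E, G ⊂ H ∧ 2 ≤ G.card := fun G hG => by
    simpa [hEdef, Finset.mem_ssubsets] using hG
  have hmem : ∀ G ∈ E, ∃ y ∈ R, 1 + Tfun u G = 1 + t * y := fun G hG => by
    obtain ⟨y, hy, h⟩ := (hT G (hE G hG).1 (hE G hG).2).mono ht
      (show 1 ≤ G.card - 1 by have := (hE G hG).2; omega)
    exact ⟨y, hy, by rw [h, pow_one]⟩
  have hκ : cumulant u H / (∏ h ∈ H, u {h}) = cumulant v H := by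
    rw [div_eq_iff (Finset.prod_ne_zero_iff.2 fun h _ => hu _), ← cumulant_mul_prod]
    exact cumulant_congr fun B _ _ => prod_powerset_two_le_card hu h0 B
  have hvw : ∀ B ⊂ H, B.Nonempty → v B = edgeWeight E id (Tfun u) B := by
    intro B hB _
    rw [edgeWeight, ← Finset.prod_filter]
    refine Finset.prod_congr ?_ fun _ _ => rfl
    ext G
    simp only [hEdef, Finset.mem_filter, Finset.mem_powerset, Finset.mem_ssubsets, id]
    exact ⟨fun h => ⟨⟨h.1.trans_ssubset hB, h.2⟩, h.1⟩, fun h => ⟨h.2, h.1.2⟩⟩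
  have hw : edgeWeight E id (Tfun u) H = ∏ G ∈ E, (1 + Tfun u G) :=
    Finset.prod_congr rfl fun G hG => if_pos (hE G hG).1.subset
  have hsmall : DivByPow R t (H.card - 1) (cumulant (edgeWeight E id (Tfun u)) H) :=
    DivByPow.cumulant_edgeWeight ht E _ H id hne fun G hG =>
      ⟨Finset.card_pos.1 (by have := (hE G hG).2; simp only [id]; omega), (hE G hG).1.subset,
        hT G (hE G hG).1 (hE G hG).2⟩
  refine ⟨∏ G ∈ E, (1 + Tfun u G), ?_, ?_, ?_, ?_⟩
  · exact Finset.prod_ne_zero_iff.2 fun G _ => one_add_Tfun_ne_zero hu G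
  · refine R.prod_mem fun G hG => ?_
    obtain ⟨y, hy, h⟩ := hmem G hG
    exact h ▸ R.add_mem R.one_mem (R.mul_mem ht hy)
  · rw [← Finset.prod_inv_distrib]
    refine R.prod_mem fun G hG => ?_
    obtain ⟨y, hy, h⟩ := hmem G hG
    exact h ▸ hunit y hy
  · have hvH : v H = (1 + Tfun u H) * ∏ G ∈ E, (1 + Tfun u G) := by
      rw [← Finset.prod_insert (f := fun G => 1 + Tfun u G) (by simp [hEdef])]
      refine Finset.prod_congr ?_ fun _ _ => rfl
      ext G
      simp only [hEdef, Finset.mem_filter, Finset.mem_powerset, Finset.mem_insert,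
        Finset.mem_ssubsets]
      constructor
      · rintro ⟨h1, h2⟩
        rcases h1.eq_or_ssubset with h | h
        · exact Or.inl h
        · exact Or.inr ⟨h, h2⟩
      · rintro (rfl | ⟨h1, h2⟩)
        · exact ⟨subset_rfl, hH⟩
        · exact ⟨h1.subset, h2⟩
    have hd := cumulant_sub_cumulant hne hvw
    rw [hvH, hw] at hd
    convert hsmall using 1
    rw [hκ]
    linear_combination hd

theorem Tfun_divByPow_iff_cumulant_divByPow {R : Subring K} {t : K} (ht : t ∈ R)
    (hunit : ∀ y ∈ R, (1 + t * y)⁻¹ ∈ R) {u : Finset α → K} (hu : ∀ I, u I ≠ 0)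
    (h0 : u ∅ = 1) :
    (∀ H : Finset α, 2 ≤ H.card → DivByPow R t (H.card - 1) (Tfun u H)) ↔
      ∀ H : Finset α, 2 ≤ H.card →
        DivByPow R t (H.card - 1) (cumulant u H / ∏ h ∈ H, u {h}) := by
  constructor
  · intro hT H hH
    obtain ⟨W, -, hW, -, hd⟩ := exists_unit_cumulant_sub_mul_Tfun ht hunit hu h0 hH
      fun G _ hG => hT G hG
    convert hd.add ((hT H hH).mul_mem hW) using 1
    ring
  · intro hκ H
    induction H using Finset.strongInduction with
    | H H ih =>
      intro hH
      obtain ⟨W, hW0, -, hW, hd⟩ := exists_unit_cumulant_sub_mul_Tfun ht hunit hu h0 hH ih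
      convert ((hκ H hH).sub hd).mul_mem hW using 1
      field_simp
      ring

end Factorization

section RationalFunctions

open Polynomial

variable {F : Type*} [Field F]

/-- The subring of rational functions that have no pole at `c`. -/
def regularAt (c : F) : Subring (RatFunc F) where
  carrier := {f | ∃ a b : F[X], b.eval c ≠ 0 ∧
    f * algebraMap F[X] (RatFunc F) b = algebraMap F[X] (RatFunc F) a}
  zero_mem' := ⟨0, 1, by simp, by simp⟩
  one_mem' := ⟨1, 1, by simp, by simp⟩
  add_mem' := by
    rintro f g ⟨a, b, hb, hf⟩ ⟨a', b', hb', hg⟩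
    refine ⟨a * b' + a' * b, b * b', by simp [hb, hb'], ?_⟩
    simp only [map_mul, map_add, ← hf, ← hg]
    ring
  mul_mem' := by
    rintro f g ⟨a, b, hb, hf⟩ ⟨a', b', hb', hg⟩
    refine ⟨a * a', b * b', by simp [hb, hb'], ?_⟩
    simp only [map_mul, ← hf, ← hg]
    ring
  neg_mem' := by
    rintro f ⟨a, b, hb, hf⟩
    exact ⟨-a, b, hb, by rw [map_neg, ← hf, neg_mul]⟩

theorem algebraMap_X_sub_C (c : F) :
    algebraMap F[X] (RatFunc F) (X - Polynomial.C c) = RatFunc.X - RatFunc.C c := by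
  rw [map_sub, RatFunc.algebraMap_X, RatFunc.algebraMap_C]

theorem X_sub_C_mem_regularAt (c : F) : RatFunc.X - RatFunc.C c ∈ regularAt c :=
  ⟨X - Polynomial.C c, 1, by simp, by rw [map_one, mul_one, algebraMap_X_sub_C]⟩

theorem algebraMap_ne_zero_of_eval_ne_zero {c : F} {b : F[X]} (hb : b.eval c ≠ 0) :
    algebraMap F[X] (RatFunc F) b ≠ 0 := by
  refine RatFunc.algebraMap_ne_zero ?_
  rintro rfl
  simp at hb

theorem inv_one_add_mem_regularAt {c : F} {y : RatFunc F} (hy : y ∈ regularAt c) :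
    (1 + (RatFunc.X - RatFunc.C c) * y)⁻¹ ∈ regularAt c := by
  obtain ⟨a, b, hb, h⟩ := hy
  have hb' : (b + (X - Polynomial.C c) * a).eval c ≠ 0 := by simpa using hb
  refine ⟨b, b + (X - Polynomial.C c) * a, hb', ?_⟩
  have he : algebraMap F[X] (RatFunc F) (b + (X - Polynomial.C c) * a) =
      (1 + (RatFunc.X - RatFunc.C c) * y) * algebraMap F[X] (RatFunc F) b := by
    rw [map_add, map_mul, algebraMap_X_sub_C, ← h]
    ring
  have hne := algebraMap_ne_zero_of_eval_ne_zero hb'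
  rw [he] at hne ⊢
  rw [inv_mul_cancel_left₀ (left_ne_zero_of_mul hne)]

theorem isOAt_pow_iff {c : F} {f : RatFunc F} {t : RatFunc F} {n : ℕ} :
    IsOAt c f (t ^ n) ↔ DivByPow (regularAt c) t n f := by
  constructor
  · rintro ⟨a, b, hb, h⟩
    have hne := algebraMap_ne_zero_of_eval_ne_zero hb
    refine ⟨algebraMap F[X] (RatFunc F) a / algebraMap F[X] (RatFunc F) b,
      ⟨a, b, hb, div_mul_cancel₀ _ hne⟩, ?_⟩
    rw [← mul_div_assoc, ← h, mul_div_cancel_right₀ _ hne]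
  · rintro ⟨y, ⟨a, b, hb, h⟩, rfl⟩
    exact ⟨a, b, hb, by rw [mul_assoc, h]⟩

end RationalFunctions

/-- for a family of nonzero rational functions `(u_I)_{I⊆[r]}` with
`u_∅ = 1`, the strong factorization property at `q = c` is equivalent to the small
cumulant property at `q = c`. -/
theorem strong_factorization_iff_small_cumulants {F : Type*} [Field F] (c : F)
    (r : ℕ) (hr : 0 < r) (u : Finset (Fin r) → RatFunc F)
    (hne : ∀ I, u I ≠ 0) (h0 : u ∅ = 1) :
    (∀ H : Finset (Fin r), 2 ≤ H.card →
      IsOAt c (Tfun u H) ((RatFunc.X - RatFunc.C c) ^ (H.card - 1)))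
    ↔ (∀ H : Finset (Fin r), 2 ≤ H.card →
      IsOAt c (cumulant u H / ∏ h ∈ H, u {h})
        ((RatFunc.X - RatFunc.C c) ^ (H.card - 1))) := by
  simp only [isOAt_pow_iff]
  exact Tfun_divByPow_iff_cumulant_divByPow (X_sub_C_mem_regularAt c)
    (fun _ => inv_one_add_mem_regularAt) hne h0
end
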